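/- (Theorem 1, relation rt-1: the symmetrized generators satisfy the RT-algebra exchange relation among annihilation generators.) The elements A_i(k) = (1/2)(a_i(k)+α_i(k)) satisfy, for all k₁,k₂ ∈ ℝ and indices i,j: A_i(k₁)A_j(k₂) = Σ_{p,q} [S₂₁(k₂,k₁)]^{(i,j)}_{(p,q)} A_q(k₂)A_p(k₁). -/

import Mathlib

open scoped Matrix BigOperators

variable {n : ℕ}

/-- `[S₂₁(k₂,k₁)]^{(i,j)}_{(p,q)} = [S(k₂,k₁)]^{(j,i)}_{(q,p)}`. -/
def S21 (S : ℝ → ℝ → Matrix (Fin n × Fin n) (Fin n × Fin n) ℂ) (k₂ k₁ : ℝ) :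
    Matrix (Fin n × Fin n) (Fin n × Fin n) ℂ :=
  Matrix.of fun x y => S k₂ k₁ (x.2, x.1) (y.2, y.1)

/-- `M₁ = M ⊗ Iₙ`. -/
def leg1 {A : Type*} [Semiring A] [DecidableEq (Fin n)]
    (M : Matrix (Fin n) (Fin n) A) :
    Matrix (Fin n × Fin n) (Fin n × Fin n) A :=
  Matrix.of fun x y => if x.2 = y.2 then M x.1 y.1 else 0

/-- `M₂ = Iₙ ⊗ M`. -/
def leg2 {A : Type*} [Semiring A] [DecidableEq (Fin n)]
    (M : Matrix (Fin n) (Fin n) A) :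
    Matrix (Fin n × Fin n) (Fin n × Fin n) A :=
  Matrix.of fun x y => if x.1 = y.1 then M x.2 y.2 else 0

/-- entrywise embedding of a scalar `n² × n²` matrix into matrices over `𝒜`. -/
def emb (𝒜 : Type*) [Ring 𝒜] [Algebra ℂ 𝒜]
    (M : Matrix (Fin n × Fin n) (Fin n × Fin n) ℂ) :
    Matrix (Fin n × Fin n) (Fin n × Fin n) 𝒜 :=
  M.map (algebraMap ℂ 𝒜)

/-- entrywise embedding of a scalar `n × n` matrix into matrices over `𝒜`. -/
def embn (𝒜 : Type*) [Ring 𝒜] [Algebra ℂ 𝒜] (M : Matrix (Fin n) (Fin n) ℂ) :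
    Matrix (Fin n) (Fin n) 𝒜 :=
  M.map (algebraMap ℂ 𝒜)

/-- `W₁₂` acting on factors 1,2 of `(ℂⁿ)^{⊗3}`. -/
def leg12 (W : Matrix (Fin n × Fin n) (Fin n × Fin n) ℂ) :
    Matrix (Fin n × Fin n × Fin n) (Fin n × Fin n × Fin n) ℂ :=
  Matrix.of fun x y => if x.2.2 = y.2.2 then W (x.1, x.2.1) (y.1, y.2.1) else 0

/-- `W₁₃` acting on factors 1,3 of `(ℂⁿ)^{⊗3}`. -/
def leg13 (W : Matrix (Fin n × Fin n) (Fin n × Fin n) ℂ) :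
    Matrix (Fin n × Fin n × Fin n) (Fin n × Fin n × Fin n) ℂ :=
  Matrix.of fun x y => if x.2.1 = y.2.1 then W (x.1, x.2.2) (y.1, y.2.2) else 0

/-- `W₂₃` acting on factors 2,3 of `(ℂⁿ)^{⊗3}`. -/
def leg23 (W : Matrix (Fin n × Fin n) (Fin n × Fin n) ℂ) :
    Matrix (Fin n × Fin n × Fin n) (Fin n × Fin n × Fin n) ℂ :=
  Matrix.of fun x y => if x.1 = y.1 then W (x.2.1, x.2.2) (y.2.1, y.2.2) else 0

section TensorVectors

variable {𝒜 : Type*} [Ring 𝒜]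

/-- The vector `u₁ v₂` with entries `uᵢ vⱼ`. -/
def tensorVec (u v : Fin n → 𝒜) : Fin n × Fin n → 𝒜 := fun x => u x.1 * v x.2

/-- The vector `v₂ u₁` with entries `vⱼ uᵢ`. -/
def tensorVecRev (u v : Fin n → 𝒜) : Fin n × Fin n → 𝒜 := fun x => v x.2 * u x.1

lemma leg1_mulVec_tensorVec (M : Matrix (Fin n) (Fin n) 𝒜) (u v : Fin n → 𝒜) :
    leg1 M *ᵥ tensorVec u v = tensorVec (M *ᵥ u) v := by
  ext ⟨i, j⟩
  simp [leg1, tensorVec, Matrix.mulVec, dotProduct, Fintype.sum_prod_type, Finset.sum_mul,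
    mul_assoc]

lemma leg2_mulVec_tensorVecRev (M : Matrix (Fin n) (Fin n) 𝒜) (u v : Fin n → 𝒜) :
    leg2 M *ᵥ tensorVecRev u v = tensorVecRev u (M *ᵥ v) := by
  ext ⟨i, j⟩
  simp [leg2, tensorVecRev, Matrix.mulVec, dotProduct, Fintype.sum_prod_type, Finset.sum_mul,
    mul_assoc]

lemma tensorVec_add_left (u u' v : Fin n → 𝒜) :
    tensorVec (u + u') v = tensorVec u v + tensorVec u' v := by
  ext; simp [tensorVec, add_mul]

lemma tensorVec_add_right (u v v' : Fin n → 𝒜) :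
    tensorVec u (v + v') = tensorVec u v + tensorVec u v' := by
  ext; simp [tensorVec, mul_add]

lemma tensorVecRev_add_left (u u' v : Fin n → 𝒜) :
    tensorVecRev (u + u') v = tensorVecRev u v + tensorVecRev u' v := by
  ext; simp [tensorVecRev, mul_add]

lemma tensorVecRev_add_right (u v v' : Fin n → 𝒜) :
    tensorVecRev u (v + v') = tensorVecRev u v + tensorVecRev u v' := by
  ext; simp [tensorVecRev, add_mul]

lemma leg1_submatrix_swap (M : Matrix (Fin n) (Fin n) 𝒜) :
    (leg1 M).submatrix Prod.swap Prod.swap = leg2 M := rfl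

lemma leg2_submatrix_swap (M : Matrix (Fin n) (Fin n) 𝒜) :
    (leg2 M).submatrix Prod.swap Prod.swap = leg1 M := rfl

end TensorVectors

section Exchange

variable {𝒜 : Type*} [Ring 𝒜] [Algebra ℂ 𝒜]

lemma emb_mul (M N : Matrix (Fin n × Fin n) (Fin n × Fin n) ℂ) :
    emb 𝒜 (M * N) = emb 𝒜 M * emb 𝒜 N :=
  Matrix.map_mul

lemma emb_one : emb 𝒜 (1 : Matrix (Fin n × Fin n) (Fin n × Fin n) ℂ) = 1 :=
  Matrix.map_one _ (map_zero _) (map_one _)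

lemma emb_mulVec_apply (M : Matrix (Fin n × Fin n) (Fin n × Fin n) ℂ) (f : Fin n × Fin n → 𝒜)
    (x : Fin n × Fin n) : (emb 𝒜 M *ᵥ f) x = ∑ p, ∑ q, M x (p, q) • f (p, q) := by
  simp [emb, Matrix.mulVec, dotProduct, Fintype.sum_prod_type, Algebra.smul_def]

/-- The exchange relation `u₁ v₂ = B v₂ u₁`. -/
def Exchange (B : Matrix (Fin n × Fin n) (Fin n × Fin n) ℂ) (u v : Fin n → 𝒜) : Prop :=
  tensorVec u v = emb 𝒜 B *ᵥ tensorVecRev u v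

lemma exchange_iff {B : Matrix (Fin n × Fin n) (Fin n × Fin n) ℂ} {u v : Fin n → 𝒜} :
    Exchange B u v ↔ ∀ i j, u i * v j = ∑ p, ∑ q, B (i, j) (p, q) • (v q * u p) := by
  simp [Exchange, funext_iff, emb_mulVec_apply, tensorVec, tensorVecRev]

lemma Exchange.add_left {B : Matrix (Fin n × Fin n) (Fin n × Fin n) ℂ} {u u' v : Fin n → 𝒜}
    (h : Exchange B u v) (h' : Exchange B u' v) : Exchange B (u + u') v := by
  rw [Exchange] at *
  rw [tensorVec_add_left, tensorVecRev_add_left, Matrix.mulVec_add, h, h']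

lemma Exchange.add_right {B : Matrix (Fin n × Fin n) (Fin n × Fin n) ℂ} {u v v' : Fin n → 𝒜}
    (h : Exchange B u v) (h' : Exchange B u v') : Exchange B u (v + v') := by
  rw [Exchange] at *
  rw [tensorVec_add_right, tensorVecRev_add_right, Matrix.mulVec_add, h, h']

lemma Exchange.smul {B : Matrix (Fin n × Fin n) (Fin n × Fin n) ℂ} {u v : Fin n → 𝒜}
    (h : Exchange B u v) (c d : ℂ) : Exchange B (c • u) (d • v) := by
  rw [exchange_iff] at *
  intro i j
  simp only [Pi.smul_apply, smul_mul_smul_comm, h i j, Finset.smul_sum, smul_smul]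
  simp only [mul_comm]

/-- Interchanging the two legs inverts the exchange matrix. -/
lemma Exchange.swap {B C : Matrix (Fin n × Fin n) (Fin n × Fin n) ℂ} {u v : Fin n → 𝒜}
    (h : Exchange B u v) (hCB : C * B = 1) :
    Exchange (C.submatrix Prod.swap Prod.swap) v u := by
  have key : emb 𝒜 C *ᵥ tensorVec u v = tensorVecRev u v := by
    rw [h, Matrix.mulVec_mulVec, ← emb_mul, hCB, emb_one, Matrix.one_mulVec]
  rw [exchange_iff]
  intro i j
  have := congrFun key (j, i)
  rw [emb_mulVec_apply, Finset.sum_comm] at this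
  exact this.symm

/-- If `u₁ M₂ = B M₂ C u₁`, then `u₁ (M v)₂ = B M₂ C u₁ v₂`. -/
lemma tensorVec_mulVec_right {B C : Matrix (Fin n × Fin n) (Fin n × Fin n) ℂ}
    {u : Fin n → 𝒜} {M : Matrix (Fin n) (Fin n) 𝒜}
    (h : ∀ i j l, u i * M j l = ∑ q, ∑ r, ∑ s, ∑ m,
      (B (i, j) (r, q) * C (r, s) (m, l)) • (M q s * u m)) (v : Fin n → 𝒜) :
    tensorVec u (M *ᵥ v) = emb 𝒜 B *ᵥ leg2 M *ᵥ emb 𝒜 C *ᵥ tensorVec u v := by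
  ext ⟨i, j⟩
  have hleg (f : Fin n × Fin n → 𝒜) (p q : Fin n) :
      (leg2 M *ᵥ f) (p, q) = ∑ s, M q s * f (p, s) := by
    simp [leg2, Matrix.mulVec, dotProduct, Fintype.sum_prod_type]
  simp only [emb_mulVec_apply, hleg]
  simp only [tensorVec, Matrix.mulVec, dotProduct, Finset.mul_sum, ← mul_assoc, h,
    Finset.sum_mul, Finset.smul_sum, mul_smul_comm, smul_mul_assoc, smul_smul]
  rw [Finset.sum_comm]
  conv_rhs => rw [Finset.sum_comm]
  refine Finset.sum_congr rfl fun q _ => ?_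
  rw [Finset.sum_comm]
  refine Finset.sum_congr rfl fun p _ => ?_
  rw [Finset.sum_comm]
  refine Finset.sum_congr rfl fun s _ => ?_
  rw [Finset.sum_comm]

/-- If `u₁ M₂ = B M₂ C u₁` and `u₁ v₂ = D v₂ u₁` with `C D = 1`, then
`u₁ (M v)₂ = B (M v)₂ u₁`. -/
lemma Exchange.mulVec_right {B C D : Matrix (Fin n × Fin n) (Fin n × Fin n) ℂ}
    {u v : Fin n → 𝒜} {M : Matrix (Fin n) (Fin n) 𝒜} (hv : Exchange D u v) (hCD : C * D = 1)
    (h : ∀ i j l, u i * M j l = ∑ q, ∑ r, ∑ s, ∑ m,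
      (B (i, j) (r, q) * C (r, s) (m, l)) • (M q s * u m)) :
    Exchange B u (M *ᵥ v) := by
  rw [Exchange, tensorVec_mulVec_right h, hv, Matrix.mulVec_mulVec _ (emb 𝒜 C), ← emb_mul, hCD,
    emb_one, Matrix.one_mulVec, leg2_mulVec_tensorVecRev]

end Exchange

theorem stmt_12
    (hn : 1 ≤ n)
    (S : ℝ → ℝ → Matrix (Fin n × Fin n) (Fin n × Fin n) ℂ)
    (hU : ∀ k₁ k₂, S k₁ k₂ * S21 S k₂ k₁ = 1)
    (hYB : ∀ k₁ k₂ k₃,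
      leg12 (S k₁ k₂) * leg13 (S k₁ k₃) * leg23 (S k₂ k₃) =
        leg23 (S k₂ k₃) * leg13 (S k₁ k₃) * leg12 (S k₁ k₂))
    (𝒜 : Type*) [Ring 𝒜] [Algebra ℂ 𝒜]
    (a ad : ℝ → Fin n → 𝒜)
    (t r : ℝ → Matrix (Fin n) (Fin n) 𝒜)
    (hZF1 : ∀ k₁ k₂ (i j : Fin n), a k₁ i * a k₂ j =
      ∑ p, ∑ q, S21 S k₂ k₁ (i, j) (p, q) • (a k₂ q * a k₁ p))
    (hZF2 : ∀ k₁ k₂ (i j : Fin n), ad k₁ i * ad k₂ j =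
      ∑ p, ∑ q, S21 S k₂ k₁ (p, q) (i, j) • (ad k₂ q * ad k₁ p))
    (hE1 : ∀ k₁ k₂ (i j l : Fin n), a k₁ i * t k₂ j l =
      ∑ q, ∑ r', ∑ s, ∑ m,
        (S21 S k₂ k₁ (i, j) (r', q) * S k₁ k₂ (r', s) (m, l)) • (t k₂ q s * a k₁ m))
    (hE2 : ∀ k₁ k₂ (i j l : Fin n), a k₁ i * r k₂ j l =
      ∑ q, ∑ r', ∑ s, ∑ m,
        (S21 S k₂ k₁ (i, j) (r', q) * S k₁ (-k₂) (r', s) (m, l)) • (r k₂ q s * a k₁ m))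
    (hE3 : ∀ k₁ k₂ (i l j : Fin n), t k₁ i l * ad k₂ j =
      ∑ p, ∑ q, ∑ r', ∑ s,
        (S k₁ k₂ (i, p) (q, r') * S21 S k₂ k₁ (s, r') (l, j)) • (ad k₂ p * t k₁ q s))
    (hE4 : ∀ k₁ k₂ (i l j : Fin n), r k₁ i l * ad k₂ j =
      ∑ p, ∑ q, ∑ r', ∑ s,
        (S k₁ k₂ (i, p) (q, r') * S21 S k₂ (-k₁) (s, r') (l, j)) • (ad k₂ p * r k₁ q s))
    (hE5 : ∀ k₁ k₂,
      emb 𝒜 (S k₁ k₂) * leg1 (t k₁) * emb 𝒜 (S21 S k₂ k₁) * leg2 (t k₂) =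
        leg2 (t k₂) * emb 𝒜 (S k₁ k₂) * leg1 (t k₁) * emb 𝒜 (S21 S k₂ k₁))
    (hE6 : ∀ k₁ k₂,
      emb 𝒜 (S k₁ k₂) * leg1 (t k₁) * emb 𝒜 (S21 S k₂ k₁) * leg2 (r k₂) =
        leg2 (r k₂) * emb 𝒜 (S k₁ (-k₂)) * leg1 (t k₁) * emb 𝒜 (S21 S (-k₂) k₁))
    (hE7 : ∀ k₁ k₂,
      emb 𝒜 (S k₁ k₂) * leg1 (r k₁) * emb 𝒜 (S21 S k₂ (-k₁)) * leg2 (r k₂) =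
        leg2 (r k₂) * emb 𝒜 (S k₁ (-k₂)) * leg1 (r k₁) * emb 𝒜 (S21 S (-k₂) (-k₁)))
    (hE8 : ∀ k, t k * t k + r k * r (-k) = 1)
    (hE9 : ∀ k, t k * r k + r k * t (-k) = 0)
    (al ald A Ad : ℝ → Fin n → 𝒜)
    (hal : ∀ k (i : Fin n), al k i = ∑ j, (t k i j * a k j + r k i j * a (-k) j))
    (hald : ∀ k (i : Fin n), ald k i = ∑ j, (ad k j * t k j i + ad (-k) j * r (-k) j i))
    (hA : ∀ k (i : Fin n), A k i = (2 : ℂ)⁻¹ • (a k i + al k i))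
    (hAd : ∀ k (i : Fin n), Ad k i = (2 : ℂ)⁻¹ • (ad k i + ald k i))
    :
    ∀ k₁ k₂ (i j : Fin n),
      A k₁ i * A k₂ j = ∑ p, ∑ q, S21 S k₂ k₁ (i, j) (p, q) • (A k₂ q * A k₁ p) := by
  have hU' (k₁ k₂ : ℝ) : S21 S k₂ k₁ * S k₁ k₂ = 1 := mul_eq_one_comm.mp (hU k₁ k₂)
  have hUe (k₁ k₂ : ℝ) : emb 𝒜 (S k₁ k₂) * emb 𝒜 (S21 S k₂ k₁) = 1 := by
    rw [← emb_mul, hU, emb_one]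
  have hUe' (k₁ k₂ : ℝ) : emb 𝒜 (S21 S k₂ k₁) * emb 𝒜 (S k₁ k₂) = 1 := by
    rw [← emb_mul, hU', emb_one]
  have haa (k₁ k₂ : ℝ) : Exchange (S21 S k₂ k₁) (a k₁) (a k₂) := exchange_iff.mpr (hZF1 k₁ k₂)
  have hal_eq (k : ℝ) : al k = t k *ᵥ a k + r k *ᵥ a (-k) := by
    ext i
    simp [hal, Matrix.mulVec, dotProduct, Finset.sum_add_distrib]
  have haal (k₁ k₂ : ℝ) : Exchange (S21 S k₂ k₁) (a k₁) (al k₂) := by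
    rw [hal_eq]
    exact ((haa k₁ k₂).mulVec_right (hU k₁ k₂) (hE1 k₁ k₂)).add_right
      ((haa k₁ (-k₂)).mulVec_right (hU k₁ (-k₂)) (hE2 k₁ k₂))
  have hala (k₁ k₂ : ℝ) : Exchange (S21 S k₂ k₁) (al k₁) (a k₂) :=
    (haal k₂ k₁).swap (hU k₂ k₁)
  have htt (k₁ k₂ : ℝ) : leg1 (t k₁) * emb 𝒜 (S21 S k₂ k₁) * leg2 (t k₂) =
      emb 𝒜 (S21 S k₂ k₁) * leg2 (t k₂) * emb 𝒜 (S k₁ k₂) * leg1 (t k₁) *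
        emb 𝒜 (S21 S k₂ k₁) := by
    have h := congrArg (emb 𝒜 (S21 S k₂ k₁) * ·) (hE5 k₁ k₂)
    simpa only [← mul_assoc, hUe', one_mul] using h
  have htr (k₁ k₂ : ℝ) : leg1 (t k₁) * emb 𝒜 (S21 S k₂ k₁) * leg2 (r k₂) =
      emb 𝒜 (S21 S k₂ k₁) * leg2 (r k₂) * emb 𝒜 (S k₁ (-k₂)) * leg1 (t k₁) *
        emb 𝒜 (S21 S (-k₂) k₁) := by
    have h := congrArg (emb 𝒜 (S21 S k₂ k₁) * ·) (hE6 k₁ k₂)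
    simpa only [← mul_assoc, hUe', one_mul] using h
  have hrr (k₁ k₂ : ℝ) : leg1 (r k₁) * emb 𝒜 (S21 S k₂ (-k₁)) * leg2 (r k₂) =
      emb 𝒜 (S21 S k₂ k₁) * leg2 (r k₂) * emb 𝒜 (S k₁ (-k₂)) * leg1 (r k₁) *
        emb 𝒜 (S21 S (-k₂) (-k₁)) := by
    have h := congrArg (emb 𝒜 (S21 S k₂ k₁) * ·) (hE7 k₁ k₂)
    simpa only [← mul_assoc, hUe', one_mul] using h
  have hrt (k₁ k₂ : ℝ) : leg1 (r k₁) * emb 𝒜 (S21 S k₂ (-k₁)) * leg2 (t k₂) =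
      emb 𝒜 (S21 S k₂ k₁) * leg2 (t k₂) * emb 𝒜 (S k₁ k₂) * leg1 (r k₁) *
        emb 𝒜 (S21 S k₂ (-k₁)) := by
    have h := congrArg (fun W => W.submatrix Prod.swap Prod.swap * emb 𝒜 (S21 S k₂ (-k₁)))
      (hE6 k₂ k₁)
    have hsw (M N : Matrix (Fin n × Fin n) (Fin n × Fin n) 𝒜) :
        (M * N).submatrix Prod.swap Prod.swap =
          M.submatrix Prod.swap Prod.swap * N.submatrix Prod.swap Prod.swap :=
      (Matrix.submatrix_mul_equiv M N Prod.swap (Equiv.prodComm _ _) Prod.swap).symm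
    have hS (k₁ k₂ : ℝ) :
        (emb 𝒜 (S k₁ k₂)).submatrix Prod.swap Prod.swap = emb 𝒜 (S21 S k₁ k₂) := rfl
    have hS21 (k₁ k₂ : ℝ) :
        (emb 𝒜 (S21 S k₁ k₂)).submatrix Prod.swap Prod.swap = emb 𝒜 (S k₁ k₂) := rfl
    simp only [hsw, hS, hS21, leg1_submatrix_swap, leg2_submatrix_swap] at h
    rw [h, mul_assoc _ (emb 𝒜 (S (-k₁) k₂)), hUe, mul_one]
  have halal (k₁ k₂ : ℝ) : Exchange (S21 S k₂ k₁) (al k₁) (al k₂) := by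
    have hleft : tensorVec (al k₁) (al k₂) =
        leg1 (t k₁) *ᵥ emb 𝒜 (S21 S k₂ k₁) *ᵥ tensorVecRev (a k₁) (al k₂) +
        leg1 (r k₁) *ᵥ emb 𝒜 (S21 S k₂ (-k₁)) *ᵥ tensorVecRev (a (-k₁)) (al k₂) := by
      rw [← haal, ← haal, leg1_mulVec_tensorVec, leg1_mulVec_tensorVec, ← tensorVec_add_left,
        ← hal_eq]
    have hmid (k : ℝ) : tensorVecRev (al k₁) (a k) = emb 𝒜 (S k₁ k) *ᵥ
        (leg1 (t k₁) *ᵥ emb 𝒜 (S21 S k k₁) *ᵥ tensorVecRev (a k₁) (a k) +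
        leg1 (r k₁) *ᵥ emb 𝒜 (S21 S k (-k₁)) *ᵥ tensorVecRev (a (-k₁)) (a k)) := by
      rw [← haa, ← haa, leg1_mulVec_tensorVec, leg1_mulVec_tensorVec, ← tensorVec_add_left,
        ← hal_eq, hala, Matrix.mulVec_mulVec, hUe, Matrix.one_mulVec]
    have hrev (u : Fin n → 𝒜) : tensorVecRev u (al k₂) =
        leg2 (t k₂) *ᵥ tensorVecRev u (a k₂) + leg2 (r k₂) *ᵥ tensorVecRev u (a (-k₂)) := by
      rw [leg2_mulVec_tensorVecRev, leg2_mulVec_tensorVecRev, ← tensorVecRev_add_right, ← hal_eq]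
    rw [Exchange, hleft, hrev, hrev, hrev, hmid, hmid]
    simp only [Matrix.mulVec_add, Matrix.mulVec_mulVec, ← mul_assoc, htt, htr, hrt, hrr]
    abel
  have hA_eq (k : ℝ) : A k = (2 : ℂ)⁻¹ • (a k + al k) := funext (hA k)
  intro k₁ k₂
  rw [← exchange_iff, hA_eq, hA_eq]
  exact (((haa k₁ k₂).add_right (haal k₁ k₂)).add_left
    ((hala k₁ k₂).add_right (halal k₁ k₂))).smul _ _
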